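/- arXiv:1904.07303 — 2 statements merged into one kernel-verified Lean document; each statement's English description precedes it below -/
import Mathlib

section
/- Correctness of the functional-encryption-for-inner-product (FEIP) decryption: let G be a commutative group, g ∈ G, η a positive integer, and let s, x, y ∈ ℤ^η and r ∈ ℤ. Define h_i = g^{s_i}, the ciphertext components ct_0 = g^r and ct_i = h_i^r · g^{x_i} for each i ∈ {1,…,η}, and the function-derived key sk_f = Σ_{i=1}^{η} y_i s_i. Then (∏_{i=1}^{η} ct_i^{y_i}) / ct_0^{sk_f} = g^{Σ_{i=1}^{η} x_i y_i}, i.e., decryption recovers g raised to the inner product ⟨x, y⟩. -/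
/-- Correctness of FEIP decryption: in a commutative group `G` with `g : G`,
master secret `s : Fin η → ℤ`, plaintext `x`, function vector `y`, randomness `r`,
with `hᵢ = g^{sᵢ}`, `ct₀ = g^r`, `ctᵢ = hᵢ^r * g^{xᵢ}`, and `sk_f = Σ yᵢ sᵢ`,
decryption recovers `g^{⟨x,y⟩}`. -/
theorem feip_decrypt_correct {G : Type*} [CommGroup G] (g : G) (η : ℕ) (hη : 0 < η)
    (s x y : Fin η → ℤ) (r : ℤ)
    (h : Fin η → G) (hh : ∀ i, h i = g ^ (s i))
    (ct0 : G) (hct0 : ct0 = g ^ r)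
    (ct : Fin η → G) (hct : ∀ i, ct i = (h i) ^ r * g ^ (x i))
    (skf : ℤ) (hskf : skf = ∑ i, y i * s i) :
    (∏ i, (ct i) ^ (y i)) / ct0 ^ skf = g ^ (∑ i, x i * y i) := by
  have key : ∀ f : Fin η → ℤ, ∏ i, g ^ f i = g ^ ∑ i, f i := by
    intro f
    have hs : ∀ S : Finset (Fin η), ∏ i ∈ S, g ^ f i = g ^ ∑ i ∈ S, f i := by
      intro S
      induction S using Finset.induction_on with
      | empty => simp
      | insert a S ha ih => rw [Finset.prod_insert ha, Finset.sum_insert ha, ih, zpow_add]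
    exact hs Finset.univ
  have hc : ∀ i, ct i ^ y i = g ^ (r * (y i * s i) + x i * y i) := by
    intro i
    rw [hct, hh, ← zpow_mul, ← zpow_add, ← zpow_mul]
    congr 1
    ring
  rw [Finset.prod_congr rfl (fun i _ => hc i), key, Finset.sum_add_distrib, ← Finset.mul_sum,
    ← hskf, hct0, ← zpow_mul, zpow_add, mul_div_cancel_left]
end

section
/- Correctness of FEBO decryption for division: let G be a group, g ∈ G an element of order p where p is prime, and s, r, x, y, z ∈ ℤ with y·z ≡ 1 (mod p). Define h = g^s, the commitment cmt = g^r, the ciphertext ct = h^r · g^x, and the function-derived key sk = (cmt^s)^{z}. Then ct^{z} / sk = g^{x·z}, and moreover ct^{z} / sk = g^{m} for every integer m satisfying m·y ≡ x (mod p); that is, decryption recovers g raised to x·y^{-1} computed modulo p. -/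
/-- Correctness of FEBO decryption for division: `g` has prime order `p`,
`z` is a multiplicative inverse of `y` modulo `p`, `h = g^s`, `cmt = g^r`,
`ct = h^r * g^x`, `sk = (cmt^s)^z`.  Then `ct^z / sk = g^{x·z}` and moreover
`ct^z / sk = g^m` for every integer `m` with `m·y ≡ x (mod p)`. -/
theorem febo_decrypt_div {G : Type*} [Group G] (g : G) (p : ℕ) (hp : p.Prime)
    (hord : orderOf g = p) (s r x y z : ℤ) (hyz : y * z ≡ 1 [ZMOD (p : ℤ)])
    (h : G) (hh : h = g ^ s)
    (cmt : G) (hcmt : cmt = g ^ r)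
    (ct : G) (hct : ct = h ^ r * g ^ x)
    (sk : G) (hsk : sk = (cmt ^ s) ^ z) :
    ct ^ z / sk = g ^ (x * z) ∧
      ∀ m : ℤ, m * y ≡ x [ZMOD (p : ℤ)] → ct ^ z / sk = g ^ m := by
  have key : ct ^ z / sk = g ^ (x * z) := by
    subst hh hcmt hct hsk
    rw [← zpow_mul, ← zpow_add, ← zpow_mul, ← zpow_mul, ← zpow_mul, div_eq_mul_inv, ← zpow_sub]
    congr 1
    ring
  refine ⟨key, fun m hm => ?_⟩
  rw [key, zpow_eq_zpow_iff_modEq, hord]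
  have h1 : m * y * z ≡ x * z [ZMOD (p : ℤ)] := hm.mul_right z
  have h2 : m * (y * z) ≡ m * 1 [ZMOD (p : ℤ)] := hyz.mul_left m
  rw [← mul_assoc, mul_one] at h2
  exact h1.symm.trans h2
end
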